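/- arXiv:1812.05079 — 3 statements merged into one kernel-verified Lean document; each statement's English description precedes it below -/
import Mathlib

section
/- Let k be a field and let S = k[X,Y,Z] be the polynomial ring in three variables over k. Then the Krull dimension of the subring R = k + X·S of S equals 3. -/
/-- For an ideal `Q` of a commutative `k`-algebra `S`, the subalgebra `k + Q` of `S`,
consisting of all elements of the form `c • 1 + q` with `c ∈ k`, `q ∈ Q`. -/
def kPlus (k : Type*) {S : Type*} [CommRing k] [CommRing S] [Algebra k S]
    (Q : Ideal S) : Subalgebra k S where
  carrier := {s : S | ∃ c : k, s - algebraMap k S c ∈ Q}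
  add_mem' := by
    rintro a b ⟨c, hc⟩ ⟨d, hd⟩
    exact ⟨c + d, by rw [map_add]; convert Q.add_mem hc hd using 1; ring⟩
  mul_mem' := by
    rintro a b ⟨c, hc⟩ ⟨d, hd⟩
    refine ⟨c * d, ?_⟩
    have : a * b - algebraMap k S (c * d)
        = a * (b - algebraMap k S d) + algebraMap k S d * (a - algebraMap k S c) := by
      rw [map_mul]; ring
    rw [this]
    exact Q.add_mem (Q.mul_mem_left _ hd) (Q.mul_mem_left _ hc)
  algebraMap_mem' := fun c => ⟨c, by simp⟩

namespace KPlusAux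
open MvPolynomial

noncomputable abbrev Q (k : Type*) [Field k] : Ideal (MvPolynomial (Fin 3) k) := Ideal.span {X 0}
noncomputable abbrev R (k : Type*) [Field k] := kPlus k (Q k)

variable {k : Type*} [Field k]

lemma memR (s : MvPolynomial (Fin 3) k) : X 0 * s ∈ R k :=
  ⟨0, by simpa using Ideal.mul_mem_right s _ (Ideal.mem_span_singleton_self _)⟩

/-- the element `X * s` of `R` -/
noncomputable def xm (s : MvPolynomial (Fin 3) k) : R k := ⟨X 0 * s, memR s⟩

lemma xm_mul (s t : MvPolynomial (Fin 3) k) : xm s * xm t = xm 1 * xm (s * t) := by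
  apply Subtype.ext; simp [xm]; ring

lemma xm_add (s t : MvPolynomial (Fin 3) k) : xm (s + t) = xm s + xm t := by
  apply Subtype.ext; simp [xm]; ring

/-- A prime containing `X` is maximal. -/
lemma maximal_of_mem (P : Ideal (R k)) [hP : P.IsPrime] (h : xm 1 ∈ P) : P.IsMaximal := by
  have hall (s : MvPolynomial (Fin 3) k) : xm s ∈ P := by
    have : xm s * xm s ∈ P := by rw [xm_mul]; exact P.mul_mem_right _ h
    exact (hP.mem_or_mem this).elim id id
  rw [Ideal.isMaximal_iff]
  refine ⟨fun h1 => hP.ne_top ((Ideal.eq_top_iff_one _).2 h1), ?_⟩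
  rintro J a hJ haP haJ
  obtain ⟨a, c, hc⟩ := a
  obtain ⟨q, hq⟩ := Ideal.mem_span_singleton.1 hc
  have e : (⟨a, c, hc⟩ : R k) = algebraMap k (R k) c + xm q := by
    apply Subtype.ext
    simp only [xm]
    change a = algebraMap k _ c + X 0 * q
    rw [← hq]; ring
  rw [e] at haP haJ
  have hc0 : c ≠ 0 := by
    rintro rfl
    exact haP (by simpa using hall q)
  have h2 : algebraMap k (R k) c ∈ J := by
    have := J.sub_mem haJ (hJ (hall q))
    simpa using this
  have := J.mul_mem_left (algebraMap k (R k) c⁻¹) h2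
  rwa [← map_mul, inv_mul_cancel₀ hc0, map_one] at this

/-- extension to `S` of a prime not containing `X` -/
noncomputable def ext (P : Ideal (R k)) (hP : P.IsPrime) : Ideal (MvPolynomial (Fin 3) k) where
  carrier := {s | xm s ∈ P}
  zero_mem' := by
    have : xm (0 : MvPolynomial (Fin 3) k) = 0 := by apply Subtype.ext; simp [xm]
    simp [this]
  add_mem' := by
    intro a b ha hb
    simp only [Set.mem_ofPred_eq, xm_add] at *
    exact P.add_mem ha hb
  smul_mem' := by
    intro c s hs
    have h : xm (c * s) * xm (c * s) ∈ P := by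
      have : xm (c * s) * xm (c * s) = xm s * xm (c * c * s) := by
        apply Subtype.ext; simp [xm]; ring
      rw [this]; exact P.mul_mem_right _ hs
    exact (hP.mem_or_mem h).elim id id

lemma mem_ext {P : Ideal (R k)} {hP : P.IsPrime} {s} : s ∈ ext P hP ↔ xm s ∈ P := Iff.rfl

lemma coe_mem_ext {P : Ideal (R k)} {hP : P.IsPrime} (h : xm 1 ∉ P) (r : R k) :
    (r : MvPolynomial (Fin 3) k) ∈ ext P hP ↔ r ∈ P := by
  have : xm (r : MvPolynomial (Fin 3) k) = xm 1 * r := by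
    apply Subtype.ext; simp [xm]
  rw [mem_ext, this]
  exact ⟨fun h' => (hP.mem_or_mem h').resolve_left h, fun h' => P.mul_mem_left _ h'⟩

lemma ext_prime {P : Ideal (R k)} (hP : P.IsPrime) (h : xm 1 ∉ P) : (ext P hP).IsPrime := by
  refine ⟨fun h1 => h ?_, ?_⟩
  · exact (Ideal.eq_top_iff_one _).1 h1
  · intro a b hab
    have : xm a * xm b ∈ P := by rw [xm_mul]; exact P.mul_mem_left _ hab
    exact hP.mem_or_mem this

lemma ext_lt {P P' : Ideal (R k)} {hP : P.IsPrime} {hP' : P'.IsPrime} (h : xm 1 ∉ P)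
    (h' : xm 1 ∉ P') (hlt : P < P') : ext P hP < ext P' hP' := by
  obtain ⟨hle, r, hr, hn⟩ := SetLike.lt_iff_le_and_exists.1 hlt
  exact SetLike.lt_iff_le_and_exists.2
    ⟨fun s hs => hle hs, (r : MvPolynomial (Fin 3) k), (coe_mem_ext h' r).2 hr, fun h2 => hn ((coe_mem_ext h r).1 h2)⟩

/-- if the extension is maximal then so is the prime -/
lemma maximal_of_ext {P : Ideal (R k)} (hP : P.IsPrime) (h : xm 1 ∉ P)
    (hm : (ext P hP).IsMaximal) : P.IsMaximal := by
  let _ := Ideal.Quotient.field (ext P hP)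
  have : Module.Finite k (MvPolynomial (Fin 3) k ⧸ ext P hP) :=
    finite_of_finite_type_of_isJacobsonRing _ _
  have hint : Algebra.IsIntegral k (MvPolynomial (Fin 3) k ⧸ ext P hP) := inferInstance
  let f : (R k ⧸ P) →ₐ[k] (MvPolynomial (Fin 3) k ⧸ ext P hP) :=
    Ideal.Quotient.liftₐ P ((Ideal.Quotient.mkₐ k (ext P hP)).comp (R k).val)
      (fun a ha => Ideal.Quotient.eq_zero_iff_mem.2 ((coe_mem_ext h a).2 ha))
  have hf : Function.Injective f := by
    rw [injective_iff_map_eq_zero]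
    intro a ha
    obtain ⟨a, rfl⟩ := Ideal.Quotient.mk_surjective a
    exact Ideal.Quotient.eq_zero_iff_mem.2
      ((coe_mem_ext (hP := hP) h a).1 (Ideal.Quotient.eq_zero_iff_mem.1 ha))
  have : Algebra.IsIntegral k (R k ⧸ P) := Algebra.IsIntegral.of_injective f hf
  have hF : IsField (R k ⧸ P) := isField_of_isIntegral_of_isField' (R := k) (S := R k ⧸ P) (Field.toIsField k)
  exact Ideal.Quotient.maximal_of_isField P hF

lemma dimS : ringKrullDim (MvPolynomial (Fin 3) k) = 3 := by
  rw [MvPolynomial.ringKrullDim_of_isNoetherianRing]; simp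

lemma upper : ringKrullDim (R k) ≤ 3 := by
  refine iSup_le fun p => ?_
  by_contra hlt
  have hlen : 4 ≤ p.length := by
    by_contra h
    apply hlt
    have : p.length ≤ 3 := by omega
    exact_mod_cast this
  let g (i : Fin 5) : PrimeSpectrum (R k) := p ⟨i, by omega⟩
  have hg : StrictMono g := fun i j hij => p.strictMono (Fin.lt_def.2 (Fin.lt_def.1 hij))
  have hlt' (i j : Fin 5) (hij : i < j) : (g i).asIdeal < (g j).asIdeal := hg hij
  have hnm (i : Fin 5) (hi : i < 4) : ¬ (g i).asIdeal.IsMaximal := fun hm =>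
    (g 4).2.ne_top (hm.1.2 _ (hlt' i 4 hi))
  have hx (i : Fin 5) (hi : i < 4) : xm 1 ∉ (g i).asIdeal := fun h =>
    hnm i hi (have := (g i).2; maximal_of_mem _ h)
  let e (i : Fin 4) : PrimeSpectrum (MvPolynomial (Fin 3) k) :=
    ⟨ext (g i.castSucc).asIdeal (g i.castSucc).2, ext_prime _ (hx _ (Fin.castSucc_lt_last i))⟩
  have he : StrictMono e := fun i j hij =>
    ext_lt (hP := (g i.castSucc).2) (hP' := (g j.castSucc).2) (hx _ (Fin.castSucc_lt_last i)) (hx _ (Fin.castSucc_lt_last j))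
      (hlt' _ _ (Fin.castSucc_lt_castSucc_iff.2 hij))
  apply hnm 3 (by decide)
  apply maximal_of_ext (g 3).2 (hx _ (by decide))
  obtain ⟨M, hM, hle⟩ := Ideal.exists_le_maximal _ (e 3).2.ne_top
  rcases eq_or_lt_of_le hle with h | h
  · rw [← h] at hM; exact hM
  · exfalso
    let s : LTSeries (PrimeSpectrum (MvPolynomial (Fin 3) k)) := LTSeries.mk 3 e he
    let s' := s.snoc ⟨M, hM.isPrime⟩ h
    have h1 := Order.LTSeries.length_le_krullDim s'
    have h2 : Order.krullDim (PrimeSpectrum (MvPolynomial (Fin 3) k)) = 3 := dimS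
    rw [h2] at h1
    have h3 : s'.length = 4 := rfl
    rw [h3] at h1
    exact absurd h1 (by decide)

/-- evaluation maps whose kernels form the chain -/
noncomputable def ev (v : Fin 3 → MvPolynomial (Fin 3) k) : R k →+* MvPolynomial (Fin 3) k :=
  ((aeval v).comp (R k).val : R k →ₐ[k] MvPolynomial (Fin 3) k).toRingHom

lemma ev_apply (v : Fin 3 → MvPolynomial (Fin 3) k) (r : R k) :
    ev v r = aeval v (r : MvPolynomial (Fin 3) k) := rfl

noncomputable def pt (v : Fin 3 → MvPolynomial (Fin 3) k) : PrimeSpectrum (R k) :=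
  ⟨RingHom.ker (ev v), RingHom.ker_isPrime _⟩

lemma pt_lt (v w u : Fin 3 → MvPolynomial (Fin 3) k) (h : ∀ i, aeval u (v i) = w i)
    (r : R k) (hr : aeval w (r : MvPolynomial (Fin 3) k) = 0)
    (hn : aeval v (r : MvPolynomial (Fin 3) k) ≠ 0) : pt v < pt w := by
  change RingHom.ker (ev v) < RingHom.ker (ev w)
  refine SetLike.lt_iff_le_and_exists.2 ⟨fun s hs => ?_, r, hr, hn⟩
  have h1 : (aeval u).comp (aeval v) = (aeval w : MvPolynomial (Fin 3) k →ₐ[k] _) := by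
    apply MvPolynomial.algHom_ext; intro i; rw [AlgHom.comp_apply, aeval_X, aeval_X, h]
  have h2 := congrArg (fun f => f (s : MvPolynomial (Fin 3) k)) h1
  rw [RingHom.mem_ker, ev_apply] at hs ⊢
  rw [← h2]; change aeval u (aeval v _) = 0; rw [hs, map_zero]

lemma lower : 3 ≤ ringKrullDim (R k) := by
  have a : pt (k := k) ![X 0, X 1, X 2] < pt ![X 0, 0, X 2] :=
    pt_lt _ _ ![X 0, 0, X 2] (by intro i; fin_cases i <;> simp) (xm (X 1))
      (by simp [xm]) (by simp [xm, X_ne_zero])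
  have b : pt (k := k) ![X 0, 0, X 2] < pt ![X 0, 0, 0] :=
    pt_lt _ _ ![X 0, 0, 0] (by intro i; fin_cases i <;> simp) (xm (X 2))
      (by simp [xm]) (by simp [xm, X_ne_zero])
  have c : pt (k := k) ![X 0, 0, 0] < pt ![1, 0, 0] :=
    pt_lt _ _ ![1, 0, 0] (by intro i; fin_cases i <;> simp) (xm 1 - 1)
      (by simp [xm]) (by
        intro h
        have := congrArg (aeval (0 : Fin 3 → k)) h
        simp [xm] at this)
  let g : Fin 4 → PrimeSpectrum (R k) :=
    ![pt ![X 0, X 1, X 2], pt ![X 0, 0, X 2], pt ![X 0, 0, 0], pt ![1, 0, 0]]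
  have hg : StrictMono g := by
    rw [Fin.strictMono_iff_lt_succ]
    intro i
    fin_cases i
    · exact a
    · exact b
    · exact c
  exact Order.LTSeries.length_le_krullDim (LTSeries.mk 3 g hg)

end KPlusAux

open MvPolynomial in
/-- Let `k` be a field and `S = k[X,Y,Z]`. Then the Krull dimension of the
subring `R = k + X·S` of `S` equals `3`. -/
theorem kPlus_xSpan_krullDim_eq_three (k : Type*) [Field k] :
    ringKrullDim
      ↥(kPlus k (Ideal.span {(X 0 : MvPolynomial (Fin 3) k)})) = 3 :=
  le_antisymm KPlusAux.upper KPlusAux.lower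
end

section
/- Let A be a commutative ring and let f, g, h be a regular sequence on A. Then the ideal-theoretic intersection fA ∩ (g,h)A equals the ideal (fg, fh)A. -/
/-- Let `A` be a commutative ring and `f, g, h` a regular sequence on
`A`.  Then `fA ∩ (g, h)A = (fg, fh)A`. -/
theorem span_inter_span_eq_of_regular (A : Type*) [CommRing A] (f g h : A)
    (hreg : RingTheory.Sequence.IsRegular A [f, g, h]) :
    Ideal.span {f} ⊓ Ideal.span {g, h} = Ideal.span {f * g, f * h} := by
  have key : ∀ (I : Ideal A) (r : A),
      IsSMulRegular (A ⧸ (I • ⊤ : Submodule A A)) r → ∀ x, r * x ∈ I → x ∈ I := by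
    intro I r hr x hx
    have e : (I • ⊤ : Submodule A A) = I := by simp
    have h1 : (Submodule.Quotient.mk x : A ⧸ (I • ⊤ : Submodule A A)) = 0 := by
      apply hr
      change r • _ = r • (0 : A ⧸ (I • ⊤ : Submodule A A))
      rw [smul_zero, ← Submodule.Quotient.mk_smul, Submodule.Quotient.mk_eq_zero, e]
      exact hx
    rw [Submodule.Quotient.mk_eq_zero, e] at h1
    exact h1
  have hg := key _ _ (hreg.toIsWeaklyRegular.regular_mod_prev 1 (by simp))
  have hh := key _ _ (hreg.toIsWeaklyRegular.regular_mod_prev 2 (by simp))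
  have e1 : Ideal.ofList ([f, g, h].take 1) = Ideal.span {f} := by simp
  have e2 : Ideal.ofList ([f, g, h].take 2) = Ideal.span {f, g} := by
    simp [Ideal.span_insert]
  rw [e1] at hg
  rw [e2] at hh
  change ∀ x, g * x ∈ _ → _ at hg
  change ∀ x, h * x ∈ _ → _ at hh
  apply le_antisymm
  · rintro y ⟨hy1, hy2⟩
    obtain ⟨x, rfl⟩ := Ideal.mem_span_singleton'.1 hy1
    obtain ⟨a, b, hab⟩ := Ideal.mem_span_pair.1 hy2
    obtain ⟨c, d, hcd⟩ := Ideal.mem_span_pair.1 (hh b (Ideal.mem_span_pair.2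
      ⟨x, -a, by linear_combination -hab⟩))
    obtain ⟨e, he⟩ := Ideal.mem_span_singleton'.1 (hg (a + h * d)
      (Ideal.mem_span_singleton'.2
        ⟨x - h * c, by linear_combination -hab - h * hcd⟩))
    exact Ideal.mem_span_pair.2
      ⟨e, c, by linear_combination hab + h * hcd + g * he⟩
  · rw [Ideal.span_le]
    rintro y (rfl | rfl)
    · exact ⟨Ideal.mul_mem_right _ _ (Ideal.subset_span (by simp)),
        Ideal.mul_mem_left _ _ (Ideal.subset_span (by simp))⟩
    · exact ⟨Ideal.mul_mem_right _ _ (Ideal.subset_span (by simp)),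
        Ideal.mul_mem_left _ _ (Ideal.subset_span (by simp))⟩
end

section
/- Let S be a Noetherian integral domain all of whose localizations at prime ideals are Cohen–Macaulay local rings, and let f be a nonzero element of S that lies in some maximal ideal of height at least 3. Then there exist elements g, h ∈ S such that f, g, h is a regular sequence on S. -/
universe u

open CategoryTheory Abelian RingTheory.Sequence IsLocalRing

section helpers

/-- Vanishing of `Ext` from the residue field below degree `n`. -/
def ExtVanish (A : Type u) [CommRing A] [IsLocalRing A] (n : ℕ) (N : Type u) [AddCommGroup N]
    [Module A N] : Prop :=
  ∀ i < n, Subsingleton (Ext (ModuleCat.of A (A ⧸ maximalIdeal A)) (ModuleCat.of A N) i)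

lemma ExtVanish.quot {A : Type u} [CommRing A] [IsLocalRing A] {n : ℕ} {N : Type u}
    [AddCommGroup N] [Module A N] (h : ExtVanish A (n + 1) N) (x : A) (hx : IsSMulRegular N x) :
    ExtVanish A n (QuotSMulTop x N) := by
  intro i hi
  have hx' : IsSMulRegular (ModuleCat.of A N) x := hx
  have zero1 := AddCommGrpCat.isZero_of_iff_subsingleton.mpr (h i (by omega))
  have zero2 := AddCommGrpCat.isZero_of_iff_subsingleton.mpr (h (i + 1) (by omega))
  exact AddCommGrpCat.subsingleton_of_isZero <| ShortComplex.Exact.isZero_of_both_zeros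
    ((Ext.covariant_sequence_exact₃' (ModuleCat.of A (A ⧸ maximalIdeal A))
      hx'.smulShortComplex_shortExact) i (i + 1) rfl)
    (zero1.eq_zero_of_src _) (zero2.eq_zero_of_tgt _)

lemma ExtVanish.exists_regular {A : Type u} [CommRing A] [IsLocalRing A] [IsNoetherianRing A]
    {n : ℕ} {N : Type u}
    [AddCommGroup N] [Module A N] [Module.Finite A N] (h : ExtVanish A (n + 1) N) :
    maximalIdeal A ∉ associatedPrimes A N := by
  intro hm
  have h1 : Subsingleton (ModuleCat.of A (A ⧸ maximalIdeal A) ⟶ ModuleCat.of A N) :=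
    Ext.addEquiv₀.subsingleton_congr.mp (h 0 n.zero_lt_succ)
  have h2 : Subsingleton ((A ⧸ maximalIdeal A) →ₗ[A] N) :=
    (ModuleCat.homAddEquiv (M := ModuleCat.of A (A ⧸ maximalIdeal A))
      (N := ModuleCat.of A N)).symm.subsingleton
  obtain ⟨x, mem_ann, hx⟩ := IsSMulRegular.subsingleton_linearMap_iff.mp h2
  rw [Ideal.annihilator_quotient] at mem_ann
  have : x ∈ ⋃ p ∈ associatedPrimes A N, (p : Set A) := Set.mem_biUnion hm mem_ann
  rw [biUnion_associatedPrimes_eq_compl_regular] at this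
  exact this hx

lemma exists_weaklyRegular {S : Type u} [CommRing S] [IsNoetherianRing S] (M : Ideal S)
    [hM : M.IsMaximal] {A : Type u} [CommRing A] [IsLocalRing A] [IsNoetherianRing A] [Algebra S A]
    [IsLocalization.AtPrime A M] (n : ℕ) {N N' : Type u} [AddCommGroup N] [Module S N]
    [Module.Finite S N] [AddCommGroup N'] [Module S N'] [Module A N'] [IsScalarTower S A N']
    (φ : N →ₗ[S] N') (hφ : IsBaseChange A φ) (h : ExtVanish A (n + 1) N') :
    ∃ g ∈ M, IsSMulRegular N g := by
  have : Module.Finite A N' := Module.Finite.equiv hφ.equiv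
  have hA := h.exists_regular
  have : IsLocalizedModule M.primeCompl φ :=
    (isLocalizedModule_iff_isBaseChange M.primeCompl A φ).mpr hφ
  have hMn : M ∉ associatedPrimes S N := fun hm => hA <|
    Module.associatedPrimes.mem_associatedPrimes_of_comap_mem_associatedPrimes_of_isLocalizedModule
      M.primeCompl φ _ (by
        rwa [show (maximalIdeal A).comap (algebraMap S A) = M from
          IsLocalization.AtPrime.under_maximalIdeal A M])
  by_contra! hcon
  have hsub : (M : Set S) ⊆ ⋃ p ∈ associatedPrimes S N, (p : Set S) := by
    rw [biUnion_associatedPrimes_eq_compl_regular]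
    exact fun g hg => hcon g hg
  obtain ⟨p, hp, hle⟩ := (Ideal.subset_union_prime_finite (associatedPrimes.finite S N)
    (f := fun p => p) ⊥ ⊥ (fun p hp _ _ => hp.1)).mp hsub
  have : M = p := hM.eq_of_le hp.1.ne_top hle
  exact hMn (this ▸ hp)

lemma quot_baseChange {S : Type u} [CommRing S] {A : Type u} [CommRing A] [Algebra S A]
    [Module.Flat S A] {N N' : Type u} [AddCommGroup N] [Module S N]
    [AddCommGroup N'] [Module S N'] [Module A N'] [IsScalarTower S A N']
    (φ : N →ₗ[S] N') (hφ : IsBaseChange A φ) (x : S) (hx : IsSMulRegular N x) :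
    IsSMulRegular N' (algebraMap S A x) ∧
    ∃ ψ : QuotSMulTop x N →ₗ[S] QuotSMulTop (algebraMap S A x) N', IsBaseChange A ψ := by
  refine ⟨hx.of_flat_of_isBaseChange hφ, ?_⟩
  have e := (QuotSMulTop.algebraMapTensorEquivTensorQuotSMulTop x N A).symm ≪≫ₗ
    QuotSMulTop.congr ((algebraMap S A) x) hφ.equiv
  exact ⟨e.toLinearMap.restrictScalars S ∘ₗ TensorProduct.mk S A (QuotSMulTop x N) 1,
    IsBaseChange.of_equiv e (fun _ ↦ by simp)⟩

end helpers



/-- A commutative ring `A` is a Cohen–Macaulay local ring if it is a Noetherian local ring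
whose depth equals its Krull dimension, i.e. there is a regular sequence on `A` consisting
of non-units (elements of the maximal ideal) whose length equals the Krull dimension
of `A`. -/
def IsCohenMacaulayLocalRing (A : Type*) [CommRing A] : Prop :=
  IsLocalRing A ∧ IsNoetherianRing A ∧
    ∃ rs : List A, (∀ x ∈ rs, ¬ IsUnit x) ∧ RingTheory.Sequence.IsRegular A rs ∧
      (rs.length : WithBot ℕ∞) = ringKrullDim A

/-- Let `S` be a Noetherian integral domain all of whose localizations at
prime ideals are Cohen–Macaulay local rings, and let `f` be a nonzero element of `S` lying
in some maximal ideal of height at least `3`.  Then there exist `g, h ∈ S` such that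
`f, g, h` is a regular sequence on `S`. -/
theorem exists_regular_sequence_extension (S : Type*) [CommRing S] [IsDomain S]
    [IsNoetherianRing S]
    (hCM : ∀ (P : Ideal S) (hP : P.IsPrime),
      haveI := hP
      IsCohenMacaulayLocalRing (Localization.AtPrime P))
    (f : S) (hf : f ≠ 0) (M : Ideal S) (hM : M.IsMaximal) (hfM : f ∈ M)
    (hht : 3 ≤ Order.height (⟨M, hM.isPrime⟩ : PrimeSpectrum S)) :
    ∃ g h : S, RingTheory.Sequence.IsRegular S [f, g, h] := by
  have hMp := hM.isPrime
  obtain ⟨hloc, hnoe, rs, hu, hreg, hlen⟩ := hCM M hM.isPrime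
  let A := Localization.AtPrime M
  have hflat : Module.Flat S A := IsLocalization.flat A M.primeCompl
  have hlen3 : 3 ≤ rs.length := by
    rw [IsLocalization.AtPrime.ringKrullDim_eq_height M A] at hlen
    have h2 : M.height = Order.height (⟨M, hM.isPrime⟩ : PrimeSpectrum S) :=
      PrimeSpectrum.height_eq_orderHeight ⟨M, hM.isPrime⟩
    rw [← h2] at hht
    have h3 : ((rs.length : ℕ∞)) = M.height := by exact_mod_cast hlen
    rw [← h3] at hht
    exact_mod_cast hht
  have hE : ExtVanish A (2 + 1) A := by
    intro i hi
    refine ModuleCat.subsingleton_ext_of_exists_isRegular (maximalIdeal A)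
      (ModuleCat.of A (A ⧸ maximalIdeal A)) ?_ (ModuleCat.of A A) ?_ rs
      (fun r hr => (mem_maximalIdeal r).mpr (hu r hr)) hreg i (by omega)
    · change Module.support A (A ⧸ maximalIdeal A) ⊆ _
      rw [Module.support_eq_zeroLocus, Ideal.annihilator_quotient]
    · change maximalIdeal A • (⊤ : Submodule A A) < ⊤
      simpa using (maximalIdeal.isMaximal A).ne_top.lt_top
  have hbc : IsBaseChange A (Algebra.linearMap S A) := IsBaseChange.linearMap S A
  have hf' : IsSMulRegular S f := fun _ _ hab => mul_left_cancel₀ hf hab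
  obtain ⟨hfA, ψ, hψ⟩ := quot_baseChange _ hbc f hf'
  have hE1 := hE.quot _ hfA
  obtain ⟨g, hgM, hg⟩ := exists_weaklyRegular M 1 ψ hψ hE1
  obtain ⟨hgA, χ, hχ⟩ := quot_baseChange _ hψ g hg
  have hE2 := hE1.quot _ hgA
  obtain ⟨h, hhM, hh⟩ := exists_weaklyRegular M 0 χ hχ hE2
  refine ⟨g, h, (isRegular_iff _ _).mpr ⟨by simp [hf', hg, hh], ?_⟩⟩
  intro htop
  apply hM.ne_top
  rw [eq_top_iff, htop]
  refine Submodule.smul_le.mpr fun r hr n _ => M.mul_mem_right n ?_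
  refine (Ideal.span_le.mpr ?_ : Ideal.ofList [f, g, h] ≤ M) hr
  intro x hx
  simp at hx
  rcases hx with rfl | rfl | rfl <;> assumption
end
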